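/- arXiv:2602.02112 — 3 statements merged into one kernel-verified Lean document; each statement's English description precedes it below -/
import Mathlib

section
/- Fix natural numbers L ≥ 1 and i with 1 ≤ i ≤ L, and ε ∈ (0,1). Let t_s = 1 − i/L, Δ = 1/L, and define α : ℝ → ℝ by α(t) = 1 − ε·t − (1 − ε)·S((t − t_s)/Δ), where S is the smoothstep. Then α(0) = 1, α(1) = 0, α is continuously differentiable on ℝ, the derivative satisfies α'(t) ≤ −ε < 0 for every t ∈ [0,1] (so α is strictly decreasing on [0,1]), and α(t) ∈ [0,1] for every t ∈ [0,1]. (Hence the ARM scheduler α_{arm,ε} is a member of the free-form scheduler class with empty input domain.) -/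
open Set

/-- The C¹ smoothstep function. -/
noncomputable def smoothstep (u : ℝ) : ℝ :=
  if u ≤ 0 then 0 else if u < 1 then 3 * u ^ 2 - 2 * u ^ 3 else 1

/-- The derivative of the smoothstep. -/
noncomputable def smoothstepD (u : ℝ) : ℝ :=
  6 * max 0 (min u 1) * (1 - max 0 (min u 1))

lemma smoothstepD_nonneg (u : ℝ) : 0 ≤ smoothstepD u := by
  unfold smoothstepD
  have h1 : (0 : ℝ) ≤ max 0 (min u 1) := le_max_left _ _
  have h2 : max 0 (min u 1) ≤ (1 : ℝ) := max_le zero_le_one (min_le_right _ _)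
  have h3 : 0 ≤ 1 - max 0 (min u 1) := by linarith
  positivity

lemma smoothstepD_continuous : Continuous smoothstepD := by
  unfold smoothstepD
  fun_prop

lemma smoothstep_quad (u v : ℝ) :
    |smoothstep v - smoothstep u - smoothstepD u * (v - u)| ≤ 3 * (v - u) ^ 2 := by
  have hD : (u ≤ 0 → smoothstepD u = 0) ∧ (1 ≤ u → smoothstepD u = 0) ∧
      (0 < u → u < 1 → smoothstepD u = 6 * u * (1 - u)) := by
    refine ⟨fun h => ?_, fun h => ?_, fun h h' => ?_⟩ <;> unfold smoothstepD
    · rw [max_eq_left ((min_le_left _ _).trans h)]; simp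
    · rw [min_eq_right h]; simp
    · rw [min_eq_left h'.le, max_eq_right h.le]
  obtain ⟨h0, h1, h2⟩ := hD
  rw [abs_le]
  rcases le_or_gt u 0 with a | a
  · rw [h0 a]
    unfold smoothstep
    rw [if_pos a]
    split_ifs with b c
    · constructor <;> nlinarith [sq_nonneg (v - u)]
    · push Not at b
      have e1 : 0 ≤ v ^ 2 * (1 - v) := by have : 0 < 1 - v := by linarith
                                          positivity
      have e2 : 0 < v ^ 3 := by positivity
      have e3 : v ^ 2 ≤ (v - u) ^ 2 := by nlinarith
      constructor <;> nlinarith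
    · constructor <;> nlinarith
  · rcases lt_or_ge u 1 with a' | a'
    · rw [h2 a a']
      unfold smoothstep
      rw [if_neg a.not_ge, if_pos a']
      split_ifs with b c
      · obtain ⟨d, hd⟩ : ∃ d, v = -d := ⟨-v, by ring⟩
        subst hd
        have hd : 0 ≤ d := by linarith
        have e1 : 0 < u ^ 3 := by positivity
        have e2 : 0 ≤ d * u := by positivity
        have e3 : 0 ≤ d * u ^ 2 := by positivity
        have e4 : 0 ≤ u ^ 2 * (1 - u) := mul_nonneg (by positivity) (by linarith)
        have e5 : 0 ≤ d * (u * (1 - u)) :=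
          mul_nonneg hd (mul_nonneg a.le (by linarith))
        constructor <;> nlinarith [sq_nonneg d]
      · push Not at b
        have e : 3 * v ^ 2 - 2 * v ^ 3 - (3 * u ^ 2 - 2 * u ^ 3) - 6 * u * (1 - u) * (v - u)
          = (v - u) ^ 2 * (3 - 4 * u - 2 * v) := by ring
        rw [e]
        constructor <;> nlinarith [sq_nonneg (v - u)]
      · push Not at c
        obtain ⟨w, rfl⟩ : ∃ w, u = 1 - w := ⟨1 - u, by ring⟩
        obtain ⟨d, rfl⟩ : ∃ d, v = 1 + d := ⟨v - 1, by ring⟩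
        have hd : 0 ≤ d := by linarith
        have hw : 0 < w := by linarith
        have hw' : 0 < 1 - w := by linarith
        have e1 : 0 < w ^ 3 := by positivity
        have e2 : 0 ≤ d * w := by positivity
        have e3 : 0 ≤ d * w ^ 2 := by positivity
        have e4 : 0 ≤ w ^ 2 * (1 - w) := by positivity
        have e5 : 0 ≤ d * (w * (1 - w)) := by positivity
        constructor <;> nlinarith [sq_nonneg d]
    · rw [h1 a']
      unfold smoothstep
      rw [if_neg a.not_ge, if_neg a'.not_gt]
      split_ifs with b c
      · constructor <;> nlinarith
      · push Not at b
        have hw : 0 < 1 - v := by linarith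
        have e1 : 0 ≤ (1 - v) ^ 2 * v := by positivity
        have e2 : 0 < (1 - v) ^ 3 := by positivity
        have e3 : (1 - v) ^ 2 ≤ (v - u) ^ 2 := by nlinarith
        constructor <;> nlinarith
      · constructor <;> nlinarith [sq_nonneg (v - u)]

lemma smoothstep_hasDerivAt (u : ℝ) : HasDerivAt smoothstep (smoothstepD u) u := by
  rw [hasDerivAt_iff_isLittleO]
  have hO : (fun v => smoothstep v - smoothstep u - (v - u) • smoothstepD u)
      =O[nhds u] fun v => (v - u) ^ 2 := by
    refine Asymptotics.IsBigO.of_bound 3 (Filter.Eventually.of_forall fun v => ?_)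
    have := smoothstep_quad u v
    rw [Real.norm_eq_abs, Real.norm_eq_abs, abs_of_nonneg (sq_nonneg (v - u)), smul_eq_mul,
      mul_comm (v - u)]
    exact this
  refine hO.trans_isLittleO ?_
  simpa only [Real.norm_eq_abs, sq_abs] using Asymptotics.isLittleO_pow_sub_sub u (m := 2) (by norm_num)

/-- The ARM scheduler `α_{arm,ε}` is a member of the free-form scheduler class
with empty input domain: `α(0) = 1`, `α(1) = 0`, `α` is C¹, `α'(t) ≤ −ε < 0`
on `[0,1]` (so `α` is strictly decreasing on `[0,1]`), and `α(t) ∈ [0,1]` for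
`t ∈ [0,1]`. -/
theorem arm_scheduler_free_form
    (L i : ℕ) (hL : 1 ≤ L) (hi1 : 1 ≤ i) (hiL : i ≤ L)
    (ε : ℝ) (hε : ε ∈ Set.Ioo (0 : ℝ) 1)
    (ts Δ : ℝ) (hts : ts = 1 - (i : ℝ) / L) (hΔ : Δ = 1 / (L : ℝ))
    (α : ℝ → ℝ)
    (hα : α = fun t => 1 - ε * t - (1 - ε) * smoothstep ((t - ts) / Δ)) :
    α 0 = 1 ∧
    α 1 = 0 ∧
    ContDiff ℝ 1 α ∧
    (∀ t ∈ Set.Icc (0 : ℝ) 1, deriv α t ≤ -ε ∧ -ε < 0) ∧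
    StrictAntiOn α (Set.Icc (0 : ℝ) 1) ∧
    (∀ t ∈ Set.Icc (0 : ℝ) 1, α t ∈ Set.Icc (0 : ℝ) 1) := by

  obtain ⟨he0, he1⟩ := hε
  have hLp : (0 : ℝ) < L := by exact_mod_cast hL
  have hΔp : 0 < Δ := by rw [hΔ]; positivity
  have hip : (1 : ℝ) ≤ i := by exact_mod_cast hi1
  have hiL' : (i : ℝ) ≤ L := by exact_mod_cast hiL
  have hts0 : 0 ≤ ts := by
    rw [hts, sub_nonneg, div_le_one hLp]; exact hiL'
  have hts1 : Δ ≤ 1 - ts := by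
    rw [hts, hΔ, sub_sub_cancel]; gcongr
  have A0 : α 0 = 1 := by
    have : (0 - ts) / Δ ≤ 0 := div_nonpos_of_nonpos_of_nonneg (by linarith) hΔp.le
    simp only [hα, smoothstep, if_pos this]; ring
  have A1 : α 1 = 0 := by
    have h : 1 ≤ (1 - ts) / Δ := by rw [le_div_iff₀ hΔp]; linarith
    have h' : ¬ (1 - ts) / Δ ≤ 0 := by linarith
    simp only [hα, smoothstep, if_neg h', if_neg h.not_gt]; ring
  have hd : ∀ t, HasDerivAt α (-ε - (1 - ε) * (smoothstepD ((t - ts) / Δ) * (1 / Δ))) t := by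
    intro t
    have h1 : HasDerivAt (fun t : ℝ => (t - ts) / Δ) (1 / Δ) t :=
      ((hasDerivAt_id t).sub_const ts).div_const Δ
    have h2 := (smoothstep_hasDerivAt ((t - ts) / Δ)).comp t h1
    have h3 := (((hasDerivAt_id t).const_mul ε).const_sub 1).sub (h2.const_mul (1 - ε))
    rw [mul_one] at h3
    rw [hα]
    exact h3
  have hder : deriv α = fun t => -ε - (1 - ε) * (smoothstepD ((t - ts) / Δ) * (1 / Δ)) :=
    funext fun t => (hd t).deriv
  have hle : ∀ t, deriv α t ≤ -ε := by
    intro t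
    rw [hder]
    have h1 := smoothstepD_nonneg ((t - ts) / Δ)
    have h2 : 0 < 1 - ε := by linarith
    have : 0 ≤ (1 - ε) * (smoothstepD ((t - ts) / Δ) * (1 / Δ)) := by positivity
    show -ε - (1 - ε) * (smoothstepD ((t - ts) / Δ) * (1 / Δ)) ≤ -ε
    linarith
  have hanti : StrictAnti α := strictAnti_of_deriv_neg fun t => by linarith [hle t]
  refine ⟨A0, A1, ?_, fun t _ => ⟨hle t, by linarith⟩, hanti.strictAntiOn _, fun t ht => ?_⟩
  · rw [contDiff_one_iff_deriv]
    refine ⟨fun t => (hd t).differentiableAt, ?_⟩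
    rw [hder]
    have := smoothstepD_continuous
    fun_prop
  · exact ⟨A1 ▸ hanti.antitone ht.2, A0 ▸ hanti.antitone ht.1⟩
end

section
/- Fix natural numbers L ≥ 1 and i with 1 ≤ i ≤ L, and ε ∈ (0,1). Let t_s = 1 − i/L, t_e = 1 − (i−1)/L, Δ = 1/L, and define α : ℝ → ℝ by α(t) = 1 − ε·t − (1 − ε)·S((t − t_s)/Δ), where S is the smoothstep. Let g : ℝ → ℝ be continuous, let C ≥ 0, K ≥ 0 and g* ∈ ℝ satisfy |g(t)| ≤ C for all t ∈ [0,1], |g*| ≤ C, and |g(t) − g*| ≤ K·ε for all t ∈ [t_s, t_e]. Then | ∫₀¹ (−α'(t))·g(t) dt − g* | ≤ (2C + K)·ε. (This quantifies the O(ε) step showing the OeMDM NELBO with the ARM scheduler reduces to the i-th autoregressive cross-entropy term.) -/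
open Set intervalIntegral

theorem smoothstep_hasDerivAt_s8 (u : ℝ) :
    HasDerivAt smoothstep (6 * max 0 (min u 1) * (1 - max 0 (min u 1))) u := by
  have hp : HasDerivAt (fun u : ℝ => 3 * u ^ 2 - 2 * u ^ 3) (6 * u * (1 - u)) u := by
    have := ((hasDerivAt_pow 2 u).const_mul 3).sub ((hasDerivAt_pow 3 u).const_mul 2)
    refine this.congr_deriv ?_
    norm_num
    ring
  have e0 : ∀ x ∈ Set.Iic (0:ℝ), smoothstep x = 0 := by
    intro x hx
    simp only [smoothstep, if_pos (Set.mem_Iic.1 hx)]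
  have e1 : ∀ x ∈ Set.Icc (0:ℝ) 1, smoothstep x = 3 * x ^ 2 - 2 * x ^ 3 := by
    intro x hx
    obtain ⟨h0, h1⟩ := hx
    unfold smoothstep
    split_ifs with h h'
    · have : x = 0 := le_antisymm h h0
      subst this; norm_num
    · rfl
    · have : x = 1 := le_antisymm h1 (not_lt.1 h')
      subst this; norm_num
  have e2 : ∀ x ∈ Set.Ici (1:ℝ), smoothstep x = 1 := by
    intro x hx
    have hx : (1:ℝ) ≤ x := hx
    simp only [smoothstep, if_neg (not_le.2 (by linarith : (0:ℝ) < x)), if_neg (not_lt.2 hx)]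
  have d0 : u ∈ Set.Iic (0:ℝ) → HasDerivWithinAt smoothstep 0 (Set.Iic 0) u := fun h =>
    (hasDerivWithinAt_const u _ (0:ℝ)).congr e0 (e0 u h)
  have d1 : u ∈ Set.Icc (0:ℝ) 1 →
      HasDerivWithinAt smoothstep (6 * u * (1 - u)) (Set.Icc 0 1) u := fun h =>
    hp.hasDerivWithinAt.congr e1 (e1 u h)
  have d2 : u ∈ Set.Ici (1:ℝ) → HasDerivWithinAt smoothstep 0 (Set.Ici 1) u := fun h =>
    (hasDerivWithinAt_const u _ (1:ℝ)).congr e2 (e2 u h)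
  rcases lt_trichotomy u 0 with h | h | h
  · have hm : max 0 (min u 1) = 0 := max_eq_left ((min_le_left _ _).trans h.le)
    rw [hm]
    simpa using (d0 h.le).hasDerivAt (Iic_mem_nhds h)
  · subst h
    have a := d0 (by simp)
    have b := d1 (by simp)
    norm_num at a b ⊢
    have := a.union b
    rw [Set.Iic_union_Icc_eq_Iic zero_le_one] at this
    exact this.hasDerivAt (Iic_mem_nhds one_pos)
  · rcases lt_trichotomy u 1 with h' | h' | h'
    · have hm : max 0 (min u 1) = u := by rw [min_eq_left h'.le, max_eq_right h.le]
      rw [hm]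
      exact (d1 ⟨h.le, h'.le⟩).hasDerivAt (Icc_mem_nhds h h')
    · subst h'
      have a := d1 (by simp)
      have b := d2 (by simp)
      norm_num at a b ⊢
      have := a.union b
      rw [Set.Icc_union_Ici_eq_Ici zero_le_one] at this
      exact this.hasDerivAt (Ici_mem_nhds one_pos)
    · have hm : max 0 (min u 1) = 1 := by rw [min_eq_right h'.le, max_eq_right zero_le_one]
      rw [hm]
      simpa using (d2 h'.le).hasDerivAt (Ici_mem_nhds h')

/-- Quantitative `O(ε)` step: with the ARM scheduler `α`, for any continuous
`g` bounded by `C` on `[0,1]` that is within `K·ε` of `g*` on the window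
`[t_s, t_e]`, the weighted integral `∫₀¹ (−α'(t))·g(t) dt` is within
`(2C + K)·ε` of `g*`. -/
theorem arm_scheduler_integral_approx
    (L i : ℕ) (hL : 1 ≤ L) (hi1 : 1 ≤ i) (hiL : i ≤ L)
    (ε : ℝ) (hε : ε ∈ Set.Ioo (0 : ℝ) 1)
    (ts te Δ : ℝ)
    (hts : ts = 1 - (i : ℝ) / L) (hte : te = 1 - ((i : ℝ) - 1) / L)
    (hΔ : Δ = 1 / (L : ℝ))
    (α : ℝ → ℝ)
    (hα : α = fun t => 1 - ε * t - (1 - ε) * smoothstep ((t - ts) / Δ))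
    (g : ℝ → ℝ) (hg : Continuous g)
    (C K gstar : ℝ) (hC : 0 ≤ C) (hK : 0 ≤ K)
    (hgC : ∀ t ∈ Set.Icc (0 : ℝ) 1, |g t| ≤ C)
    (hgstarC : |gstar| ≤ C)
    (hgwin : ∀ t ∈ Set.Icc ts te, |g t - gstar| ≤ K * ε) :
    |(∫ t in (0 : ℝ)..1, (-(deriv α t)) * g t) - gstar| ≤ (2 * C + K) * ε := by
  obtain ⟨hε0, hε1⟩ := hε
  have hLpos : (0:ℝ) < L := by exact_mod_cast hL
  have hΔpos : 0 < Δ := by rw [hΔ]; positivity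
  have hi1' : (1:ℝ) ≤ i := by exact_mod_cast hi1
  have hiL' : (i:ℝ) ≤ L := by exact_mod_cast hiL
  have hts0 : 0 ≤ ts := by
    rw [hts, sub_nonneg, div_le_one hLpos]; exact hiL'
  have hteΔ : te = ts + Δ := by rw [hts, hte, hΔ]; ring
  have hte1 : te ≤ 1 := by
    rw [hte]
    have : 0 ≤ ((i:ℝ) - 1) / L := div_nonneg (by linarith) hLpos.le
    linarith
  let m : ℝ → ℝ := fun t => max 0 (min ((t - ts) / Δ) 1)
  let w : ℝ → ℝ := fun t => 6 * m t * (1 - m t) * (1 / Δ)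
  have hmc : Continuous m := by fun_prop
  have hwc : Continuous w := by fun_prop
  have hm0 : ∀ t, 0 ≤ m t := fun t => le_max_left _ _
  have hm1 : ∀ t, m t ≤ 1 := fun t => max_le zero_le_one (min_le_right _ _)
  have hw0 : ∀ t, 0 ≤ w t := by
    intro t
    have h1 := hm0 t
    have h2 : 0 ≤ 1 - m t := sub_nonneg.2 (hm1 t)
    have h3 : 0 ≤ 1 / Δ := by positivity
    exact mul_nonneg (mul_nonneg (mul_nonneg (by norm_num) h1) h2) h3
  have hwd : ∀ t, HasDerivAt (fun t => smoothstep ((t - ts) / Δ)) (w t) t := by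
    intro t
    have h1 : HasDerivAt (fun t : ℝ => (t - ts) / Δ) (1 / Δ) t :=
      ((hasDerivAt_id t).sub_const ts).div_const Δ
    exact (smoothstep_hasDerivAt_s8 ((t - ts) / Δ)).comp t h1
  have hwint : ∫ t in (0:ℝ)..1, w t = 1 := by
    rw [intervalIntegral.integral_eq_sub_of_hasDerivAt (fun t _ => hwd t)
      (hwc.intervalIntegrable 0 1)]
    have h1 : (1:ℝ) ≤ (1 - ts) / Δ := by rw [le_div_iff₀ hΔpos]; linarith
    have h0 : (0 - ts) / Δ ≤ 0 := div_nonpos_of_nonpos_of_nonneg (by linarith) hΔpos.le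
    have s1 : smoothstep ((1 - ts) / Δ) = 1 := by
      unfold smoothstep
      rw [if_neg (by linarith), if_neg (by linarith)]
    have s0 : smoothstep ((0 - ts) / Δ) = 0 := by
      unfold smoothstep
      rw [if_pos h0]
    rw [s1, s0]; norm_num
  have hd : ∀ t, -(deriv α t) = ε + (1 - ε) * w t := by
    intro t
    have h : HasDerivAt α (0 - ε * 1 - (1 - ε) * w t) t := by
      rw [hα]
      exact ((hasDerivAt_const t (1:ℝ)).sub ((hasDerivAt_id t).const_mul ε)).sub
        ((hwd t).const_mul (1 - ε))
    rw [h.deriv]; ring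
  have hwz : ∀ t, t ∉ Set.Icc ts te → w t = 0 := by
    intro t ht
    by_cases h : t < ts
    · have : m t = 0 := max_eq_left ((min_le_left _ _).trans
        (div_nonpos_of_nonpos_of_nonneg (by linarith) hΔpos.le))
      simp [w, this]
    · have h2 : te < t := by
        by_contra h3
        exact ht ⟨not_lt.1 h, not_lt.1 h3⟩
      have h4 : (1:ℝ) ≤ (t - ts) / Δ := by rw [le_div_iff₀ hΔpos]; linarith
      have : m t = 1 := by
        simp only [m]
        rw [min_eq_right h4, max_eq_right zero_le_one]
      simp [w, this]
  have hone : ∫ t in (0:ℝ)..1, (ε + (1 - ε) * w t) = 1 := by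
    rw [intervalIntegral.integral_add (by simp)
      ((hwc.const_mul (1 - ε)).intervalIntegrable 0 1),
      intervalIntegral.integral_const_mul, hwint]
    simp
  have hrew : (∫ t in (0 : ℝ)..1, (-(deriv α t)) * g t) - gstar
      = ∫ t in (0:ℝ)..1, (ε + (1 - ε) * w t) * (g t - gstar) := by
    simp only [hd, mul_sub]
    rw [intervalIntegral.integral_sub
      ((by fun_prop : Continuous fun t => (ε + (1 - ε) * w t) * g t).intervalIntegrable 0 1)
      ((by fun_prop : Continuous fun t =>
        (ε + (1 - ε) * w t) * gstar).intervalIntegrable 0 1),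
      intervalIntegral.integral_mul_const, hone, one_mul]
  have hbint : ∫ t in (0:ℝ)..1, (2 * C * ε + w t * (K * ε)) = (2 * C + K) * ε := by
    rw [intervalIntegral.integral_add (by simp)
      ((hwc.mul_const (K * ε)).intervalIntegrable 0 1),
      intervalIntegral.integral_mul_const (K * ε) w, hwint, intervalIntegral.integral_const]
    simp only [smul_eq_mul]
    ring
  rw [hrew, ← hbint, ← Real.norm_eq_abs]
  refine intervalIntegral.norm_integral_le_of_norm_le zero_le_one ?_
    ((by fun_prop : Continuous fun t => 2 * C * ε + w t * (K * ε)).intervalIntegrable 0 1)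
  refine Filter.Eventually.of_forall fun t ht => ?_
  have hKε : 0 ≤ K * ε := mul_nonneg hK hε0.le
  have hgt : |g t - gstar| ≤ 2 * C := by
    have h1 := hgC t ⟨ht.1.le, ht.2⟩
    have h2 := abs_sub (g t) gstar
    linarith
  have hwg : w t * |g t - gstar| ≤ w t * (K * ε) := by
    by_cases h : t ∈ Set.Icc ts te
    · exact mul_le_mul_of_nonneg_left (hgwin t h) (hw0 t)
    · simp [hwz t h]
  have hpos : 0 ≤ ε + (1 - ε) * w t :=
    add_nonneg hε0.le (mul_nonneg (by linarith) (hw0 t))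
  rw [Real.norm_eq_abs, abs_mul, abs_of_nonneg hpos]
  have h5 : 0 ≤ w t * |g t - gstar| := mul_nonneg (hw0 t) (abs_nonneg _)
  nlinarith [mul_le_mul_of_nonneg_left hgt hε0.le, mul_nonneg hε0.le h5]
end

section
/- Let t ∈ ℝ and let α, β : ℝ → ℝ be differentiable at t with α(t) < 1, β(t) < 1, α'(t) < 0, and β'(t) < 0. Set A = −α'(t)/(1 − α(t)) and Â = −β'(t)/(1 − β(t)), and fix c ∈ (0,1]. For Δ > 0 define F(Δ) = ((α(t−Δ) − α(t))/(1 − α(t))) · log( ((α(t−Δ) − α(t))·(1 − β(t))) / ((1 − α(t))·(β(t−Δ) − β(t))·c) ) + ((1 − α(t−Δ))/(1 − α(t))) · log( ((1 − α(t−Δ))·(1 − β(t))) / ((1 − α(t))·(1 − β(t−Δ))) ). Then F(Δ)/Δ tends to −A·log c + A·(log A − log Â) − (A − Â) as Δ → 0 from the right. (This is the continuous-time limit T·KL → L_main + L_velocity of the per-token discrete-time KL divergence between the true reverse posterior with scheduler α and the model reverse kernel with scheduler β and predicted token probability c.) -/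
open Real Filter

theorem kl_aux_deriv (t : ℝ) (f : ℝ → ℝ) (f' : ℝ) (hf : HasDerivAt f f' t) :
    HasDerivAt (fun x => (f (t - x) - f t) / (1 - f t)) (-f' / (1 - f t)) 0 := by
  have h1 : HasDerivAt (fun x : ℝ => t - x) (-1) 0 := by
    simpa using (hasDerivAt_id (0 : ℝ)).const_sub t
  have hf0 : HasDerivAt f f' (t - 0) := by simpa using hf
  have h2 := HasDerivAt.comp (0 : ℝ) hf0 h1
  have h3 := (h2.sub_const (f t)).div_const (1 - f t)
  simpa using h3

theorem kl_aux_slope (p : ℝ → ℝ) (P : ℝ) (hp : HasDerivAt p P 0) (h0 : p 0 = 0) :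
    Filter.Tendsto (fun x => p x / x) (nhdsWithin 0 (Set.Ioi (0 : ℝ))) (nhds P) := by
  have h := hp.tendsto_slope_zero_right
  refine h.congr fun x => ?_
  simp [h0, div_eq_inv_mul]

/-- Continuous-time limit `T·KL → L_main + L_velocity` of the per-token
discrete-time KL divergence between the true reverse posterior (scheduler `α`)
and the model reverse kernel (scheduler `β`, predicted token probability `c`). -/
theorem kl_continuous_time_limit
    (t : ℝ) (α β : ℝ → ℝ) (a' b' : ℝ)
    (hα : HasDerivAt α a' t) (hβ : HasDerivAt β b' t)
    (hα1 : α t < 1) (hβ1 : β t < 1) (ha' : a' < 0) (hb' : b' < 0)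
    (A Ahat : ℝ) (hA : A = -a' / (1 - α t)) (hAhat : Ahat = -b' / (1 - β t))
    (c : ℝ) (hc : c ∈ Set.Ioc (0 : ℝ) 1)
    (F : ℝ → ℝ)
    (hF : F = fun Δ =>
      ((α (t - Δ) - α t) / (1 - α t)) *
        Real.log (((α (t - Δ) - α t) * (1 - β t)) /
          ((1 - α t) * (β (t - Δ) - β t) * c)) +
      ((1 - α (t - Δ)) / (1 - α t)) *
        Real.log (((1 - α (t - Δ)) * (1 - β t)) /
          ((1 - α t) * (1 - β (t - Δ)))) ) :
    Filter.Tendsto (fun Δ => F Δ / Δ) (nhdsWithin 0 (Set.Ioi (0 : ℝ)))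
      (nhds (-A * Real.log c + A * (Real.log A - Real.log Ahat) - (A - Ahat))) := by
  have hc0 : c ≠ 0 := hc.1.ne'
  have hC : 0 < 1 - α t := by linarith
  have hB : 0 < 1 - β t := by linarith
  have hA0 : 0 < A := by rw [hA]; exact div_pos (by linarith) hC
  have hAh0 : 0 < Ahat := by rw [hAhat]; exact div_pos (by linarith) hB
  have hp := kl_aux_deriv t α a' hα
  have hq := kl_aux_deriv t β b' hβ
  rw [← hA] at hp
  rw [← hAhat] at hq
  set p : ℝ → ℝ := fun x => (α (t - x) - α t) / (1 - α t) with hpdef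
  set q : ℝ → ℝ := fun x => (β (t - x) - β t) / (1 - β t) with hqdef
  have hp0 : p 0 = 0 := by simp [hpdef]
  have hq0 : q 0 = 0 := by simp [hqdef]
  have sp := kl_aux_slope p A hp hp0
  have sq := kl_aux_slope q Ahat hq hq0
  have T1 : Filter.Tendsto (fun x => p x / x * Real.log ((p x / x) / (q x / x * c)))
      (nhdsWithin 0 (Set.Ioi (0 : ℝ))) (nhds (A * Real.log (A / (Ahat * c)))) := by
    have hne : Ahat * c ≠ 0 := mul_ne_zero hAh0.ne' hc0
    exact sp.mul ((sp.div (sq.mul_const c) hne).log (div_ne_zero hA0.ne' hne))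
  have hr : HasDerivAt (fun x => (1 - p x) * Real.log ((1 - p x) / (1 - q x)))
      (-A + Ahat) 0 := by
    have h1 := hp.const_sub 1
    have h2 := hq.const_sub 1
    have h3 := (h1.fun_div h2 (by simp [hq0])).log (by simp [hp0, hq0])
    have h4 := h1.fun_mul h3
    refine HasDerivAt.congr_deriv h4 ?_
    simp [hp0, hq0]
  have T2 := kl_aux_slope _ _ hr (by simp [hp0, hq0])
  have T := T1.add T2
  have hlim : A * Real.log (A / (Ahat * c)) + (-A + Ahat)
      = -A * Real.log c + A * (Real.log A - Real.log Ahat) - (A - Ahat) := by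
    rw [Real.log_div hA0.ne' (mul_ne_zero hAh0.ne' hc0), Real.log_mul hAh0.ne' hc0]
    ring
  rw [hlim] at T
  refine T.congr' ?_
  filter_upwards [self_mem_nhdsWithin] with x hx
  have hx0 : x ≠ 0 := ne_of_gt hx
  have e1 : p x / x / (q x / x * c) = ((α (t - x) - α t) * (1 - β t)) /
          ((1 - α t) * (β (t - x) - β t) * c) := by
    simp only [hpdef, hqdef]
    by_cases hy : β (t - x) - β t = 0
    · simp [hy]
    · field_simp
  have e2 : 1 - p x = (1 - α (t - x)) / (1 - α t) := by
    simp only [hpdef]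
    field_simp
    ring
  have e3 : 1 - q x = (1 - β (t - x)) / (1 - β t) := by
    simp only [hqdef]
    field_simp
    ring
  have e4 : (1 - p x) / (1 - q x) = ((1 - α (t - x)) * (1 - β t)) /
          ((1 - α t) * (1 - β (t - x))) := by
    rw [e2, e3, div_div_div_eq]
  rw [hF, e1, e4, e2]
  simp only [hpdef]
  ring
end
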